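/- Let {X_n} be a stationary and ergodic time series with values in a finite or countably infinite set 𝒳, and fix 0 < γ < 1, 0 < β with 2β + γ < 1. Then for every k, P(Δ̂_k^n ≤ n^{−β} eventually in n, and K(X̃⁰_{−∞}) = k) = P(K(X̃⁰_{−∞}) = k); consequently, almost surely on the event { K(X̃⁰_{−∞}) = k } one has χ_n ≤ k eventually. -/

import Mathlib

open MeasureTheory Filter Set
open scoped ENNReal Topology

noncomputable section

namespace MWPrediction

/-- The canonical two-sided path space for a process with values in `𝒳`. -/
abbrev Path (𝒳 : Type*) := ℤ → 𝒳

variable {𝒳 : Type*}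

/-- The left shift `(T ω) i = ω (i+1)` on two-sided sequences. -/
def shift (ω : Path 𝒳) : Path 𝒳 := fun i => ω (i + 1)

/-- The one-sided past `X⁰_{-∞}`, recorded as `past ω i = X_{-i}`. -/
def past (ω : Path 𝒳) : ℕ → 𝒳 := fun i => ω (-(i : ℤ))

/-- The string `s` of length `m` (read right-to-left: `s j` is the symbol at
position `t - j`) occurs in `ω` ending at time `t`. -/
def OccursAt (ω : Path 𝒳) (m : ℕ) (s : ℕ → 𝒳) (t : ℤ) : Prop :=
  ∀ j < m, ω (t - (j : ℤ)) = s j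

/-- The auxiliary stopping times `ζ_n`:  `ζ_0 = 0` and `ζ_n` is obtained from
`ζ_{n-1}` by waiting for the recurrence of the block of length `l n` ending
at `ζ_{n-1}`. -/
def zeta (l : ℕ → ℕ) (ω : Path 𝒳) : ℕ → ℤ
  | 0 => 0
  | n + 1 =>
    zeta l ω n +
      ((sInf {t : ℕ | 0 < t ∧ ∀ s < l (n + 1),
          ω (zeta l ω n - (s : ℤ) + (t : ℤ)) = ω (zeta l ω n - (s : ℤ))} : ℕ) : ℤ)

/-- `J n = min { j ≥ 1 : l (j+1) > n }`. -/
def Jfun (l : ℕ → ℕ) (n : ℕ) : ℕ := sInf {j : ℕ | 1 ≤ j ∧ n < l (j + 1)}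

/-- The auxiliary process `X̃`: `tildePast l ω i = X̃_{-i} = X_{ζ_{J(i)} - i}`. -/
def tildePast (l : ℕ → ℕ) (ω : Path 𝒳) : ℕ → 𝒳 :=
  fun i => ω (zeta l ω (Jfun l i) - (i : ℤ))

variable [MeasurableSpace 𝒳]

/-- `pstr μ m s = P(X_{-m+1}^0 = s)`, the probability that the string `s` of
length `m` (read right-to-left) occupies positions `-m+1, …, 0`.
(So `pstr μ (k+1)` is `p_k` of the paper.) -/
def pstr (μ : Measure (Path 𝒳)) (m : ℕ) (s : ℕ → 𝒳) : ℝ :=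
  (μ {ω | ∀ j < m, ω (-(j : ℤ)) = s j}).toReal

/-- `pcond μ m y s = P(X_1 = y | X_{-m+1}^0 = s)`, conditioning on `m` symbols.
(So `pcond μ m` is `p_{m-1}(·|·)` of the paper.) -/
def pcond (μ : Measure (Path 𝒳)) (m : ℕ) (y : 𝒳) (s : ℕ → 𝒳) : ℝ :=
  (μ {ω | ω 1 = y ∧ ∀ j < m, ω (-(j : ℤ)) = s j}).toReal / pstr μ m s

/-- Append `y` as the new rightmost symbol of the string `s`. -/
def withLast (y : 𝒳) (s : ℕ → 𝒳) : ℕ → 𝒳 := fun j => if j = 0 then y else s (j - 1)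

/-- The string which agrees with `b` on its rightmost `k` symbols and continues
to the left with `z`:  this is the string `(z, b_{-k+1}^0)` of the paper. -/
def prependOld (b : ℕ → 𝒳) (k : ℕ) (z : ℕ → 𝒳) : ℕ → 𝒳 :=
  fun j => if j < k then b j else z (j - k)

/-- `K` is a memory bound for the past `b`: for all `i ≥ 1`, `y` and `z ∈ 𝒳^i`,
if `p_{K+i}(z, b_{-K+1}^0, y) > 0` then
`p_{K-1}(y | b_{-K+1}^0) = p_{K+i-1}(y | z, b_{-K+1}^0)`. -/
def IsMemoryBound (μ : Measure (Path 𝒳)) (b : ℕ → 𝒳) (K : ℕ) : Prop :=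
  ∀ i : ℕ, 1 ≤ i → ∀ y : 𝒳, ∀ z : ℕ → 𝒳,
    0 < pstr μ (K + i + 1) (withLast y (prependOld b K z)) →
    pcond μ K y b = pcond μ (K + i) y (prependOld b K z)

/-- The (random) memory length `K(b)` of a one-sided path `b`: the smallest
memory bound, and `∞` if there is none. -/
def memLen (μ : Measure (Path 𝒳)) (b : ℕ → 𝒳) : ℕ∞ :=
  sInf {n : ℕ∞ | ∃ K : ℕ, n = (K : ℕ∞) ∧ IsMemoryBound μ b K}

/-- `Δ_k(b_{-k+1}^0)`. -/
def Delta (μ : Measure (Path 𝒳)) (k : ℕ) (b : ℕ → 𝒳) : ℝ :=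
  sSup {d : ℝ | ∃ i : ℕ, 1 ≤ i ∧ ∃ z : ℕ → 𝒳, ∃ x : 𝒳,
    0 < pstr μ (k + i + 1) (withLast x (prependOld b k z)) ∧
    d = |pcond μ k x b - pcond μ (k + i) x (prependOld b k z)|}

/-- `⌈n/2⌉`. -/
def half (n : ℕ) : ℕ := (n + 1) / 2

open Classical in
/-- The number of times `t ∈ [a, b]` at which the string `s` of length `m`
occurs in `ω` ending at `t`. -/
def cnt (ω : Path 𝒳) (m : ℕ) (s : ℕ → 𝒳) (a b : ℤ) : ℕ :=
  ((Finset.Icc a b).filter fun t => OccursAt ω m s t).card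

/-- Membership in `ℒ_{n,m}^{(1)}`: the string `s` of length `m+1` occurs in
`X_0^{⌈n/2⌉ - 1}`. -/
def inL1 (ω : Path 𝒳) (n m : ℕ) (s : ℕ → 𝒳) : Prop :=
  ∃ t : ℤ, (m : ℤ) ≤ t ∧ t ≤ (half n : ℤ) - 1 ∧ OccursAt ω (m + 1) s t

/-- Membership in `ℒ_{n,m}^{(2)}`: the string `s` of length `m+1` occurs more
than `n^{1-γ}` times in `X_{⌈n/2⌉}^n`. -/
def inL2 (γ : ℝ) (ω : Path 𝒳) (n m : ℕ) (s : ℕ → 𝒳) : Prop :=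
  (n : ℝ) ^ (1 - γ) < (cnt ω (m + 1) s ((half n : ℤ) + (m : ℤ)) (n : ℤ) : ℝ)

/-- Membership in `ℒ_m^n = ℒ_{n,m}^{(1)} ∩ ℒ_{n,m}^{(2)}`. -/
def inL (γ : ℝ) (ω : Path 𝒳) (n m : ℕ) (s : ℕ → 𝒳) : Prop :=
  inL1 ω n m s ∧ inL2 γ ω n m s

/-- The empirical conditional relative frequency of `x` following the string
`s` of length `m`, computed in the second half `X_{⌈n/2⌉}^n` of the data. -/
def empCond (ω : Path 𝒳) (n m : ℕ) (x : 𝒳) (s : ℕ → 𝒳) : ℝ :=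
  (cnt ω (m + 1) (withLast x s) ((half n : ℤ) + (m : ℤ)) (n : ℤ) : ℝ) /
    (cnt ω m s ((half n : ℤ) + (m : ℤ) - 1) ((n : ℤ) - 1) : ℝ)

/-- The empirical statistic `Δ̂_k^n(X̃_{-k+1}^0)`. -/
def hatDelta (γ : ℝ) (l : ℕ → ℕ) (ω : Path 𝒳) (n k : ℕ) : ℝ :=
  (if zeta l ω (Jfun l k) ≤ (half n : ℤ) - 1 then (1 : ℝ) else 0) *
    sSup {d : ℝ | ∃ i : ℕ, 1 ≤ i ∧ i ≤ n ∧ ∃ z : ℕ → 𝒳, ∃ x : 𝒳,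
      inL γ ω n (k + i) (withLast x (prependOld (tildePast l ω) k z)) ∧
      d = |empCond ω n k x (tildePast l ω) -
            empCond ω n (k + i) x (prependOld (tildePast l ω) k z)|}

/-- The order estimate `χ_n`: the smallest `0 ≤ k < n` with `Δ̂_k^n ≤ n^{-β}`
(and `χ_0 = 0`). -/
def chi (β γ : ℝ) (l : ℕ → ℕ) (ω : Path 𝒳) (n : ℕ) : ℕ :=
  sInf {k : ℕ | k < n ∧ hatDelta γ l ω n k ≤ (n : ℝ) ^ (-β)}

/-- The index `j` with `ζ_j ≤ v < ζ_{j+1}`. -/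
def jIndex (l : ℕ → ℕ) (ω : Path 𝒳) (v : ℤ) : ℕ := sInf {j : ℕ | v < zeta l ω (j + 1)}

/-- The stopping times `λ_n`:  `λ_0 = 0` and, if `ζ_j ≤ λ_{n-1} < ζ_{j+1}`,
`λ_n = min { t > λ_{n-1} : X_{t - χ_t + 1}^t = X_{ζ_j - χ_t + 1}^{ζ_j} }`. -/
def lambda (β γ : ℝ) (l : ℕ → ℕ) (ω : Path 𝒳) : ℕ → ℤ
  | 0 => 0
  | n + 1 =>
    lambda β γ l ω n + 1 +
      ((sInf {s : ℕ |
          ∀ r < chi β γ l ω (lambda β γ l ω n + 1 + (s : ℤ)).toNat,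
            ω (lambda β γ l ω n + 1 + (s : ℤ) - (r : ℤ)) =
              ω (zeta l ω (jIndex l ω (lambda β γ l ω n)) - (r : ℤ))} : ℕ) : ℤ)

/-- `κ_n = χ_{λ_n}`. -/
def kappa (β γ : ℝ) (l : ℕ → ℕ) (ω : Path 𝒳) (n : ℕ) : ℕ :=
  chi β γ l ω (lambda β γ l ω n).toNat

/-- The estimator `f_n = (1/n) ∑_{j=0}^{n-1} f(X_{λ_j + 1})`. -/
def fEst (β γ : ℝ) (l : ℕ → ℕ) (f : 𝒳 → ℝ) (ω : Path 𝒳) (n : ℕ) : ℝ :=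
  (1 / (n : ℝ)) * ∑ j ∈ Finset.range n, f (ω (lambda β γ l ω j + 1))

open Classical in
/-- The metric `d*` on one-sided sequences. -/
def dstar (x y : ℕ → 𝒳) : ℝ :=
  ∑' i : ℕ, (2 : ℝ)⁻¹ ^ (i + 1) * (if x i ≠ y i then 1 else 0)

/-- `F` restricted to `C` is continuous with respect to the metric `d*`. -/
def ContinuousOnDstar (F : (ℕ → 𝒳) → ℝ) (C : Set (ℕ → 𝒳)) : Prop :=
  ∀ x ∈ C, ∀ ε > 0, ∃ δ > 0, ∀ y ∈ C, dstar x y < δ → |F y - F x| < ε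

/-- The σ-algebra generated by the one-sided past `X^0_{-∞}`. -/
def pastSigma (𝒳 : Type*) [MeasurableSpace 𝒳] : MeasurableSpace (Path 𝒳) :=
  MeasurableSpace.comap past inferInstance

/-- `F` is a version of the conditional expectation `E(f(X_1) | X^0_{-∞})`. -/
def IsPredictor (μ : Measure (Path 𝒳)) (f : 𝒳 → ℝ) (F : (ℕ → 𝒳) → ℝ) : Prop :=
  (fun ω => F (past ω)) =ᵐ[μ] μ[fun ω => f (ω 1)|pastSigma 𝒳]

/-- `F` (a version of `E(f(X_1)|X^0_{-∞})`) is almost surely continuous: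
it is continuous w.r.t. `d*` on a set of paths of probability one. -/
def ASContinuousCondExp (μ : Measure (Path 𝒳)) (F : (ℕ → 𝒳) → ℝ) : Prop :=
  ∃ C : Set (ℕ → 𝒳), μ (past ⁻¹' C) = 1 ∧ ContinuousOnDstar F C

/-- The observation `(λ_j, X_0^{λ_j})`, encoding the data segment available at
time `λ_j` (values before time `0` are clamped to `X_0`). -/
def segObs (β γ : ℝ) (l : ℕ → ℕ) (j : ℕ) (ω : Path 𝒳) : ℤ × (ℕ → 𝒳) :=
  (lambda β γ l ω j, fun i => ω (max (lambda β γ l ω j - (i : ℤ)) 0))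

/-- The σ-algebra generated by `(λ_j, X_0^{λ_j})`. -/
def segSigma (β γ : ℝ) (l : ℕ → ℕ) (j : ℕ) : MeasurableSpace (Path 𝒳) :=
  MeasurableSpace.comap (segObs β γ l j) inferInstance

/-- The observation `(λ_j, X_{-∞}^{λ_j})`: the full past at time `λ_j`. -/
def fullPastObs (β γ : ℝ) (l : ℕ → ℕ) (j : ℕ) (ω : Path 𝒳) : ℤ × (ℕ → 𝒳) :=
  (lambda β γ l ω j, fun i => ω (lambda β γ l ω j - (i : ℤ)))

/-- The σ-algebra generated by `(λ_j, X_{-∞}^{λ_j})`. -/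
def fullPastSigma (β γ : ℝ) (l : ℕ → ℕ) (j : ℕ) : MeasurableSpace (Path 𝒳) :=
  MeasurableSpace.comap (fullPastObs β γ l j) inferInstance

/-- The `n`-th term `-(1/(n+1)) ∑ p log₂ p` of the entropy rate. -/
def entropyTerm (μ : Measure (Path 𝒳)) (n : ℕ) : ℝ :=
  -(1 / ((n : ℝ) + 1)) *
    ∑' s : Fin (n + 1) → 𝒳,
      pstr μ (n + 1) (fun j => if h : j < n + 1 then s ⟨j, h⟩ else s ⟨0, Nat.succ_pos n⟩) *
        Real.logb 2
          (pstr μ (n + 1) (fun j => if h : j < n + 1 then s ⟨j, h⟩ else s ⟨0, Nat.succ_pos n⟩))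

/-- The process has entropy rate `H`. -/
def HasEntropyRate (μ : Measure (Path 𝒳)) (H : ℝ) : Prop :=
  Tendsto (entropyTerm μ) atTop (nhds H)

/-- The backward stopping times `ζ̂_i^k`. -/
def hatZeta (l : ℕ → ℕ) (k : ℕ) (ω : Path 𝒳) : ℕ → ℤ
  | 0 => 0
  | i + 1 =>
    hatZeta l k ω i -
      ((sInf {t : ℕ | 0 < t ∧ ∀ s < l (k - i),
          ω (hatZeta l k ω i - (s : ℤ) - (t : ℤ)) = ω (hatZeta l k ω i - (s : ℤ))} : ℕ) : ℤ)


theorem cnt_congr {α : Type*} (ω : Path α) {m : ℕ} {s s' : ℕ → α} (h : ∀ j < m, s j = s' j) (a b : ℤ) :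
    cnt ω m s a b = cnt ω m s' a b := by
  have : ∀ t, OccursAt ω m s t ↔ OccursAt ω m s' t := fun t =>
    forall₂_congr fun j hj => by rw [h j hj]
  classical
  unfold cnt
  congr 1
  exact Finset.filter_congr fun t _ => this t

theorem cnt_mono_left {α : Type*} {ω : Path α} {m m' : ℕ} {s s' : ℕ → α} {a a' b : ℤ} (hm : m' ≤ m)
    (ha : a' ≤ a) (h : ∀ j < m', s j = s' j) : cnt ω m s a b ≤ cnt ω m' s' a' b := by
  classical
  unfold cnt
  apply Finset.card_le_card
  intro t
  simp only [Finset.mem_filter, Finset.mem_Icc]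
  rintro ⟨⟨h1, h2⟩, h3⟩
  exact ⟨⟨ha.trans h1, h2⟩, fun j hj => by rw [h3 j (hj.trans_le hm), h j hj]⟩

theorem occursAt_withLast {α : Type*} (ω : Path α) (m : ℕ) (x : α) (s : ℕ → α) (t : ℤ) :
    OccursAt ω (m + 1) (withLast x s) (t + 1) ↔ OccursAt ω m s t ∧ ω (t + 1) = x := by
  constructor
  · intro h
    refine ⟨fun j hj => ?_, by simpa [withLast] using h 0 (by omega)⟩
    have := h (j + 1) (by omega)
    simp only [withLast, Nat.cast_add, Nat.cast_one, Nat.add_one_ne_zero, if_false,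
      Nat.add_sub_cancel] at this
    rw [← this]; congr 1; ring
  · rintro ⟨h, hx⟩ j hj
    cases j with
    | zero => simpa [withLast] using hx
    | succ j =>
      have := h j (by omega)
      simp only [withLast, Nat.cast_add, Nat.cast_one, Nat.add_one_ne_zero, if_false,
        Nat.add_sub_cancel]
      rw [← this]; congr 1; ring

theorem setOf_next_eq {α : Type*} (m : ℕ) (x : α) (s : ℕ → α) :
    {ω : Path α | ω 1 = x ∧ ∀ j < m, ω (-(j : ℤ)) = s j} =
      {ω | OccursAt ω (m + 1) (withLast x s) ((0 : ℕ) + 1 : ℤ)} := by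
  ext ω
  have := occursAt_withLast ω m x s 0
  simp only [Set.mem_ofPred_eq, Nat.cast_zero, this]
  simp [OccursAt, and_comm]

theorem prependOld_eq_self {α : Type*} {b s : ℕ → α} {k : ℕ} (h : ∀ j < k, s j = b j) :
    prependOld b k (fun j => s (j + k)) = s := by
  funext j
  unfold prependOld
  split_ifs with hj
  · exact (h j hj).symm
  · exact congrArg s (Nat.sub_add_cancel (not_lt.mp hj))

theorem prependOld_congr {α : Type*} {b b' : ℕ → α} {k : ℕ} (h : ∀ j < k, b j = b' j) (z : ℕ → α) :
    prependOld b k z = prependOld b' k z := by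
  funext j
  unfold prependOld
  split_ifs with hj
  · exact h j hj
  · rfl

theorem empCond_congr {α : Type*} (ω : Path α) (n : ℕ) {m : ℕ} (x : α) {s s' : ℕ → α}
    (h : ∀ j < m, s j = s' j) : empCond ω n m x s = empCond ω n m x s' := by
  unfold empCond
  rw [cnt_congr ω h, cnt_congr ω (s := withLast x s) (s' := withLast x s')]
  intro j hj
  unfold withLast
  split_ifs with h0
  · rfl
  · exact h _ (by omega)

theorem shift_iterate_apply {α : Type*} (T : ℕ) (ω : Path α) (i : ℤ) : shift^[T] ω i = ω (i + T) := by
  induction T generalizing ω with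
  | zero => simp
  | succ T ih =>
    rw [Function.iterate_succ_apply, ih]
    simp only [shift]
    congr 1; push_cast; ring

theorem pstr_congr (μ : Measure (Path 𝒳)) {m : ℕ} {s s' : ℕ → 𝒳} (h : ∀ j < m, s j = s' j) :
    pstr μ m s = pstr μ m s' := by
  unfold pstr
  congr 3 with ω
  exact forall₂_congr fun j hj => by rw [h j hj]

theorem pcond_congr (μ : Measure (Path 𝒳)) {m : ℕ} (y : 𝒳) {s s' : ℕ → 𝒳}
    (h : ∀ j < m, s j = s' j) : pcond μ m y s = pcond μ m y s' := by
  unfold pcond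
  rw [pstr_congr μ h]
  congr 4 with ω
  exact and_congr_right fun _ => forall₂_congr fun j hj => by rw [h j hj]

theorem IsMemoryBound.congr {μ : Measure (Path 𝒳)} {b b' : ℕ → 𝒳} {k : ℕ}
    (hb : IsMemoryBound μ b k) (h : ∀ j < k, b j = b' j) : IsMemoryBound μ b' k := by
  intro i hi y z hz
  rw [← prependOld_congr h] at hz ⊢
  rw [← pcond_congr μ y h]
  exact hb i hi y z hz

theorem isMemoryBound_of_memLen_eq {μ : Measure (Path 𝒳)} {b : ℕ → 𝒳} {k : ℕ}
    (h : memLen μ b = k) : IsMemoryBound μ b k := by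
  have hne : {n : ℕ∞ | ∃ K : ℕ, n = (K : ℕ∞) ∧ IsMemoryBound μ b K}.Nonempty := by
    by_contra hne
    rw [Set.not_nonempty_iff_eq_empty] at hne
    simp [memLen, hne] at h
  obtain ⟨K, hK, hKb⟩ := csInf_mem hne
  have : (k : ℕ∞) = K := h.symm.trans hK
  rwa [Nat.cast_inj.mp this]

theorem toReal_measure_occursAt_zero (μ : Measure (Path 𝒳)) (m : ℕ) (s : ℕ → 𝒳) :
    (μ {ω | OccursAt ω m s 0}).toReal = pstr μ m s := by
  simp [pstr, OccursAt]

theorem pcond_nonneg (μ : Measure (Path 𝒳)) (m : ℕ) (y : 𝒳) (s : ℕ → 𝒳) :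
    0 ≤ pcond μ m y s := by
  unfold pcond pstr; positivity

theorem pcond_le_one (μ : Measure (Path 𝒳)) [IsProbabilityMeasure μ] (m : ℕ) (y : 𝒳)
    (s : ℕ → 𝒳) : pcond μ m y s ≤ 1 := by
  unfold pcond pstr
  refine div_le_one_of_le₀ ?_ ENNReal.toReal_nonneg
  exact ENNReal.toReal_mono (measure_ne_top _ _) (measure_mono fun ω hω => hω.2)

theorem toReal_measure_next (μ : Measure (Path 𝒳)) [IsProbabilityMeasure μ] (m : ℕ) (y : 𝒳)
    (s : ℕ → 𝒳) :
    (μ {ω | ω 1 = y ∧ ∀ j < m, ω (-(j : ℤ)) = s j}).toReal = pcond μ m y s * pstr μ m s := by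
  unfold pcond
  rcases eq_or_ne (pstr μ m s) 0 with h0 | h0
  · rw [h0, mul_zero]
    refine le_antisymm (h0 ▸ ?_) ENNReal.toReal_nonneg
    exact ENNReal.toReal_mono (measure_ne_top _ _) (measure_mono fun ω hω => hω.2)
  · rw [div_mul_cancel₀ _ h0]

section Stationary

variable [MeasurableSingletonClass 𝒳]

theorem measurableSet_coord_eq (i : ℤ) (x : 𝒳) : MeasurableSet {ω : Path 𝒳 | ω i = x} :=
  measurable_pi_apply (X := fun _ => 𝒳) i (measurableSet_singleton x)

theorem measurableSet_occursAt (m : ℕ) (s : ℕ → 𝒳) (t : ℤ) :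
    MeasurableSet {ω : Path 𝒳 | OccursAt ω m s t} := by
  simp only [OccursAt, Set.ofPred_forall]
  exact MeasurableSet.iInter fun j => MeasurableSet.iInter fun _ => measurableSet_coord_eq _ _

theorem measure_occursAt {μ : Measure (Path 𝒳)} (hμ : MeasurePreserving (shift : Path 𝒳 → _) μ μ)
    (m : ℕ) (s : ℕ → 𝒳) (T : ℕ) :
    μ {ω | OccursAt ω m s T} = μ {ω | OccursAt ω m s 0} := by
  rw [← (hμ.iterate T).measure_preimage (measurableSet_occursAt m s 0).nullMeasurableSet]
  congr 1 with ω
  refine forall₂_congr fun j _ => ?_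
  rw [shift_iterate_apply]
  ring_nf

theorem toReal_measure_next_eq_pstr {μ : Measure (Path 𝒳)}
    (hμ : MeasurePreserving (shift : Path 𝒳 → _) μ μ) (m : ℕ) (x : 𝒳) (s : ℕ → 𝒳) :
    (μ {ω | ω 1 = x ∧ ∀ j < m, ω (-(j : ℤ)) = s j}).toReal = pstr μ (m + 1) (withLast x s) := by
  have := measure_occursAt hμ (m + 1) (withLast x s) 1
  rw [setOf_next_eq, ← toReal_measure_occursAt_zero, ← this]
  simp

variable [Countable 𝒳]

theorem hasSum_measure_next (μ : Measure (Path 𝒳)) [IsProbabilityMeasure μ] (m : ℕ) (s : ℕ → 𝒳) :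
    HasSum (fun y => (μ {ω | ω 1 = y ∧ ∀ j < m, ω (-(j : ℤ)) = s j}).toReal) (pstr μ m s) := by
  have hC : MeasurableSet {ω : Path 𝒳 | ∀ j < m, ω (-(j : ℤ)) = s j} := by
    simpa [OccursAt] using measurableSet_occursAt m s 0
  have hU : {ω : Path 𝒳 | ∀ j < m, ω (-(j : ℤ)) = s j} =
      ⋃ y, {ω | ω 1 = y ∧ ∀ j < m, ω (-(j : ℤ)) = s j} := by
    ext ω; simp
  have hdisj : Pairwise (Function.onFun Disjoint
      fun y => {ω : Path 𝒳 | ω 1 = y ∧ ∀ j < m, ω (-(j : ℤ)) = s j}) := by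
    intro y y' hyy'
    refine Set.disjoint_left.mpr ?_
    rintro ω ⟨h1, -⟩ ⟨h2, -⟩
    exact hyy' (h1.symm.trans h2)
  have hsum : ∑' y, μ {ω | ω 1 = y ∧ ∀ j < m, ω (-(j : ℤ)) = s j} =
      μ {ω | ∀ j < m, ω (-(j : ℤ)) = s j} := by
    rw [hU, measure_iUnion hdisj fun y => (measurableSet_coord_eq 1 y).inter hC]
  have := ENNReal.hasSum_toReal (f := fun y => μ {ω | ω 1 = y ∧ ∀ j < m, ω (-(j : ℤ)) = s j})
    (by rw [hsum]; exact measure_ne_top _ _)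
  rwa [← ENNReal.tsum_toReal_eq (fun _ => measure_ne_top _ _), hsum] at this

theorem hasSum_pcond (μ : Measure (Path 𝒳)) [IsProbabilityMeasure μ] {m : ℕ} {s : ℕ → 𝒳}
    (h : pstr μ m s ≠ 0) : HasSum (fun y => pcond μ m y s) 1 := by
  have := (hasSum_measure_next μ m s).div_const (pstr μ m s)
  rwa [div_self h] at this

/-- After a memory word, the next symbol has the same conditional law given any longer past. -/
theorem IsMemoryBound.pcond_eq {μ : Measure (Path 𝒳)} [IsProbabilityMeasure μ]
    (hμ : MeasurePreserving (shift : Path 𝒳 → _) μ μ) {b s : ℕ → 𝒳} {k m : ℕ}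
    (hb : IsMemoryBound μ b k) (hkm : k ≤ m) (hs : ∀ j < k, s j = b j) (hpos : pstr μ m s ≠ 0)
    (x : 𝒳) : pcond μ m x s = pcond μ k x b := by
  rcases hkm.eq_or_lt with rfl | hlt
  · exact pcond_congr μ x hs
  obtain ⟨i, rfl⟩ := Nat.exists_eq_add_of_le hkm
  have key : ∀ y, pcond μ (k + i) y s ≠ 0 → pcond μ (k + i) y s = pcond μ k y b := by
    intro y hy
    have := hb i (by omega) y (fun j => s (j + k))
    rw [prependOld_eq_self hs, ← toReal_measure_next_eq_pstr hμ, toReal_measure_next] at this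
    refine (this ?_).symm
    exact lt_of_le_of_ne (mul_nonneg (pcond_nonneg _ _ _ _) ENNReal.toReal_nonneg)
      (mul_ne_zero hy hpos).symm
  have hposb : pstr μ k b ≠ 0 := by
    rw [← pstr_congr μ hs]
    have h1 : pstr μ (k + i) s ≤ pstr μ k s :=
      ENNReal.toReal_mono (measure_ne_top _ _)
        (measure_mono fun ω hω j hj => hω j (hj.trans_le hkm))
    have h2 : 0 ≤ pstr μ (k + i) s := ENNReal.toReal_nonneg
    exact ((lt_of_le_of_ne h2 hpos.symm).trans_le h1).ne'
  have hdiff := (hasSum_pcond μ hposb).sub (hasSum_pcond μ hpos)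
  rw [sub_self, hasSum_zero_iff_of_nonneg] at hdiff
  · exact (sub_eq_zero.mp (congrFun hdiff x)).symm
  · intro y
    change 0 ≤ pcond μ k y b - pcond μ (k + i) y s
    by_cases hy : pcond μ (k + i) y s = 0
    · rw [hy, sub_zero]; exact pcond_nonneg _ _ _ _
    · rw [key y hy, sub_self]

theorem IsMemoryBound.toReal_measure_occursAt {μ : Measure (Path 𝒳)} [IsProbabilityMeasure μ]
    (hμ : MeasurePreserving (shift : Path 𝒳 → _) μ μ) {b s : ℕ → 𝒳} {k m : ℕ}
    (hb : IsMemoryBound μ b k) (hkm : k ≤ m) (hs : ∀ j < k, s j = b j) (x : 𝒳) (T : ℕ) :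
    (μ ({ω | OccursAt ω m s T} ∩ {ω | ω (T + 1) = x})).toReal =
      pcond μ k x b * (μ {ω | OccursAt ω m s T}).toReal := by
  have h1 : ({ω : Path 𝒳 | OccursAt ω m s T} ∩ {ω | ω (T + 1) = x}) =
      {ω | OccursAt ω (m + 1) (withLast x s) ((T + 1 : ℕ) : ℤ)} := by
    ext ω; simp [occursAt_withLast]
  rw [h1, measure_occursAt hμ, measure_occursAt hμ, toReal_measure_occursAt_zero,
    toReal_measure_occursAt_zero, ← toReal_measure_next_eq_pstr hμ, toReal_measure_next]
  rcases eq_or_ne (pstr μ m s) 0 with h0 | h0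
  · simp [h0]
  · rw [hb.pcond_eq hμ hkm hs h0]

end Stationary

/-- `G` depends only on the coordinates in `[0, T]`. -/
def SegDetermined {α β : Type*} (T : ℕ) (G : Path α → β) : Prop :=
  ∀ ω ω' : Path α, (∀ i : ℤ, 0 ≤ i → i ≤ T → ω i = ω' i) → G ω = G ω'

/-- The block of length `m` ending at time `t`, read right-to-left. -/
def seg {α : Type*} (m : ℕ) (t : ℤ) (ω : Path α) : Fin m → α := fun j => ω (t - (j : ℤ))

theorem seg_preimage_singleton {α : Type*} (m : ℕ) (t : ℤ) (ω₀ : Path α) :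
    seg m t ⁻¹' {seg m t ω₀} = {ω | OccursAt ω m (fun j => ω₀ (t - j)) t} := by
  ext ω
  simp only [Set.mem_preimage, Set.mem_singleton_iff, funext_iff, seg, Fin.forall_iff,
    Set.mem_ofPred_eq, OccursAt]

theorem SegDetermined.eq_of_occursAt {α β : Type*} {T : ℕ} {G : Path α → β}
    (hG : SegDetermined T G) {ω ω₀ : Path α}
    (h : OccursAt ω (T + 1) (fun j => ω₀ ((T : ℤ) - j)) T) : G ω = G ω₀ := by
  refine hG _ _ fun i h0 hT => ?_
  have := h ((T : ℤ) - i).toNat (by omega)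
  dsimp only at this
  rwa [Int.toNat_of_nonneg (by omega), sub_sub_cancel] at this

section Countable

variable [MeasurableSingletonClass 𝒳] [Countable 𝒳]

theorem measurable_seg {𝒳 : Type*} [MeasurableSpace 𝒳] (m : ℕ) (t : ℤ) :
    Measurable (seg m t : Path 𝒳 → _) :=
  measurable_pi_lambda _ fun _ => measurable_pi_apply _

theorem lintegral_eq_tsum_fiber {Ω ι : Type*} [MeasurableSpace Ω] [MeasurableSpace ι]
    [MeasurableSingletonClass ι] [Countable ι] (μ : Measure Ω) {ρ : Ω → ι} (hρ : Measurable ρ)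
    (f : Ω → ℝ≥0∞) : ∫⁻ ω, f ω ∂μ = ∑' u, ∫⁻ ω in ρ ⁻¹' {u}, f ω ∂μ := by
  rw [← lintegral_iUnion (fun u => hρ (measurableSet_singleton u))
    (fun u v huv => Disjoint.preimage ρ (Set.disjoint_singleton.mpr huv)),
    ← Set.preimage_iUnion, Set.iUnion_of_singleton, Set.preimage_univ, Measure.restrict_univ]

theorem measure_le_mul_of_fiber {Ω ι : Type*} [MeasurableSpace Ω] [MeasurableSpace ι]
    [MeasurableSingletonClass ι] [Countable ι] (μ : Measure Ω) [IsProbabilityMeasure μ]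
    {ρ : Ω → ι} (hρ : Measurable ρ) {E : Set Ω} {c : ℝ≥0∞}
    (h : ∀ ω₀ ∈ E, μ (ρ ⁻¹' {ρ ω₀} ∩ E) ≤ c * μ (ρ ⁻¹' {ρ ω₀})) : μ E ≤ c := by
  calc μ E ≤ μ (⋃ u, ρ ⁻¹' {u} ∩ E) :=
        measure_mono fun ω hω => Set.mem_iUnion.mpr ⟨ρ ω, rfl, hω⟩
    _ ≤ ∑' u, μ (ρ ⁻¹' {u} ∩ E) := measure_iUnion_le _
    _ ≤ ∑' u, c * μ (ρ ⁻¹' {u}) := by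
        refine ENNReal.tsum_le_tsum fun u => ?_
        rcases (ρ ⁻¹' {u} ∩ E).eq_empty_or_nonempty with he | ⟨ω, rfl, hω⟩
        · simp [he]
        · exact h ω hω
    _ = c * ∫⁻ _, 1 ∂μ := by
        rw [lintegral_eq_tsum_fiber μ hρ, ENNReal.tsum_mul_left]
        simp
    _ = c := by simp

theorem SegDetermined.measurable {β : Type*} [MeasurableSpace β] {T : ℕ} {G : Path 𝒳 → β}
    (hG : SegDetermined T G) : Measurable G := by
  let e : (Fin (T + 1) → 𝒳) → Path 𝒳 := fun v i => v (Fin.ofNat (T + 1) ((T : ℤ) - i).toNat)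
  have h : G = (G ∘ e) ∘ seg (T + 1) T := by
    funext ω
    refine hG _ _ fun i h0 hT => ?_
    have hlt : ((T : ℤ) - i).toNat < T + 1 := by omega
    simp only [e, seg, Fin.ofNat, Nat.mod_eq_of_lt hlt]
    rw [Int.toNat_of_nonneg (by omega)]
    congr 1; ring
  rw [h]
  exact (measurable_of_countable _).comp (measurable_seg _ _)

theorem SegDetermined.lintegral_mul_le {μ : Measure (Path 𝒳)} {T : ℕ} {G : Path 𝒳 → ℝ≥0∞}
    (hG : SegDetermined T G) {g : Path 𝒳 → ℝ≥0∞} (hg : Measurable g)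
    (h : ∀ s : ℕ → 𝒳, ∫⁻ ω in {ω | OccursAt ω (T + 1) s T}, g ω ∂μ ≤
      μ {ω | OccursAt ω (T + 1) s T}) :
    ∫⁻ ω, G ω * g ω ∂μ ≤ ∫⁻ ω, G ω ∂μ := by
  rw [lintegral_eq_tsum_fiber μ (measurable_seg (T + 1) (T : ℤ)),
    lintegral_eq_tsum_fiber μ (measurable_seg (T + 1) (T : ℤ)) G]
  refine ENNReal.tsum_le_tsum fun u => ?_
  rcases (seg (T + 1) (T : ℤ) ⁻¹' {u}).eq_empty_or_nonempty with he | ⟨ω₀, rfl⟩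
  · simp [he]
  rw [seg_preimage_singleton]
  have hm := measurableSet_occursAt (T + 1) (fun j => ω₀ ((T : ℤ) - j)) T
  calc _ = ∫⁻ ω in {ω | OccursAt ω (T + 1) (fun j => ω₀ ((T : ℤ) - j)) T}, G ω₀ * g ω ∂μ :=
        setLIntegral_congr_fun hm fun ω hω => by simp only [hG.eq_of_occursAt hω]
    _ = G ω₀ * ∫⁻ ω in {ω | OccursAt ω (T + 1) (fun j => ω₀ ((T : ℤ) - j)) T}, g ω ∂μ :=
        lintegral_const_mul _ hg
    _ ≤ G ω₀ * μ {ω | OccursAt ω (T + 1) (fun j => ω₀ ((T : ℤ) - j)) T} := by gcongr; exact h _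
    _ = ∫⁻ ω in {ω | OccursAt ω (T + 1) (fun j => ω₀ ((T : ℤ) - j)) T}, G ω₀ ∂μ := by simp
    _ = _ := setLIntegral_congr_fun hm fun ω hω => by simp only [hG.eq_of_occursAt hω]

end Countable

open Classical in
/-- The increment at time `t` of the compensated logarithmic weight: it vanishes unless the string
`s` of length `m` ends at `t`, and then it compares the next symbol with `x`. -/
def logIncr {α : Type*} (c p : ℝ) (m : ℕ) (x : α) (s : ℕ → α) (t : ℤ) (ω : Path α) : ℝ :=
  if OccursAt ω m s t then c * ((if ω (t + 1) = x then 1 else 0) - p) - c ^ 2 else 0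

theorem sum_logIncr {α : Type*} (c p : ℝ) (m : ℕ) (x : α) (s : ℕ → α) (a L : ℕ) (ω : Path α) :
    ∑ i ∈ Finset.range L, logIncr c p m x s ((a + i : ℕ) : ℤ) ω =
      c * (cnt ω (m + 1) (withLast x s) ((a : ℤ) + 1) ((a : ℤ) + L) -
        p * cnt ω m s a ((a : ℤ) + L - 1)) - c ^ 2 * cnt ω m s a ((a : ℤ) + L - 1) := by
  classical
  induction L with
  | zero => simp [cnt]
  | succ L ih =>
    have h1 : Finset.Icc ((a : ℤ) + 1) ((a : ℤ) + (L + 1 : ℕ)) =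
        insert ((a + L : ℕ) + 1 : ℤ) (Finset.Icc ((a : ℤ) + 1) ((a : ℤ) + L)) := by
      ext t; simp only [Finset.mem_insert, Finset.mem_Icc]; omega
    have h2 : Finset.Icc (a : ℤ) ((a : ℤ) + (L + 1 : ℕ) - 1) =
        insert ((a + L : ℕ) : ℤ) (Finset.Icc (a : ℤ) ((a : ℤ) + L - 1)) := by
      ext t; simp only [Finset.mem_insert, Finset.mem_Icc]; omega
    have h3 : cnt ω m s a ((a : ℤ) + (L + 1 : ℕ) - 1) = cnt ω m s a ((a : ℤ) + L - 1) +
        if OccursAt ω m s ((a + L : ℕ) : ℤ) then 1 else 0 := by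
      unfold cnt
      rw [h2, Finset.filter_insert]
      split_ifs
      · rw [Finset.card_insert_of_notMem]
        simp only [Finset.mem_filter, Finset.mem_Icc]; omega
      · rfl
    have h4 : cnt ω (m + 1) (withLast x s) ((a : ℤ) + 1) ((a : ℤ) + (L + 1 : ℕ)) =
        cnt ω (m + 1) (withLast x s) ((a : ℤ) + 1) ((a : ℤ) + L) +
        if OccursAt ω m s ((a + L : ℕ) : ℤ) ∧ ω ((a + L : ℕ) + 1) = x then 1 else 0 := by
      unfold cnt
      rw [h1, Finset.filter_insert]
      simp only [← occursAt_withLast]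
      split_ifs
      · rw [Finset.card_insert_of_notMem]
        simp only [Finset.mem_filter, Finset.mem_Icc]; omega
      · rfl
    rw [Finset.sum_range_succ, ih, h3, h4]
    unfold logIncr
    by_cases hs : OccursAt ω m s ((a + L : ℕ) : ℤ)
    · by_cases hx : ω ((a + L : ℕ) + 1) = x
      · simp only [hs, hx, and_self, if_true]; push_cast; ring
      · simp only [hs, hx, and_false, if_true, if_false]; push_cast; ring
    · simp only [hs, false_and, if_false]; push_cast; ring

theorem segDetermined_logIncr {α : Type*} (c p : ℝ) {m : ℕ} (x : α) (s : ℕ → α) {t T : ℕ}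
    (hm : m ≤ t + 1) (hT : t + 1 ≤ T) : SegDetermined T (logIncr c p m x s (t : ℤ)) := by
  intro ω ω' h
  unfold logIncr
  have h1 : OccursAt ω m s t ↔ OccursAt ω' m s t :=
    forall₂_congr fun j hj => by rw [h _ (by omega) (by omega)]
  rw [h _ (by omega : (0 : ℤ) ≤ t + 1) (by omega)]
  by_cases hs : OccursAt ω m s t
  · rw [if_pos hs, if_pos (h1.mp hs)]
  · rw [if_neg hs, if_neg (mt h1.mpr hs)]

theorem bernoulli_exp_le_one {c p : ℝ} (hc : |c| ≤ 1) (hp0 : 0 ≤ p) (hp1 : p ≤ 1) :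
    p * Real.exp (c * (1 - p) - c ^ 2) + (1 - p) * Real.exp (c * (0 - p) - c ^ 2) ≤ 1 := by
  have key : ∀ q : ℝ, |q| ≤ 1 → Real.exp (c * q) ≤ 1 + c * q + c ^ 2 := by
    intro q hq
    have h1 : |c * q| ≤ 1 := by
      rw [abs_mul]; exact mul_le_one₀ hc (abs_nonneg _) hq
    have h2 := (abs_le.mp (Real.abs_exp_sub_one_sub_id_le h1)).2
    have h3 : (c * q) ^ 2 ≤ c ^ 2 := by
      rw [mul_pow]
      exact mul_le_of_le_one_right (sq_nonneg c) ((sq_le_one_iff_abs_le_one q).mpr hq)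
    linarith
  have h1 := key (1 - p) (abs_le.mpr ⟨by linarith, by linarith⟩)
  have h2 := key (0 - p) (abs_le.mpr ⟨by linarith, by linarith⟩)
  have h3 : p * Real.exp (c * (1 - p)) + (1 - p) * Real.exp (c * (0 - p)) ≤ Real.exp (c ^ 2) := by
    have h4 := mul_le_mul_of_nonneg_left h1 hp0
    have h5 := mul_le_mul_of_nonneg_left h2 (sub_nonneg.mpr hp1)
    have h6 := Real.add_one_le_exp (c ^ 2)
    nlinarith
  rw [Real.exp_sub, Real.exp_sub, ← mul_div_assoc, ← mul_div_assoc, ← add_div]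
  exact div_le_one_of_le₀ h3 (Real.exp_pos _).le

section Chernoff

variable [MeasurableSingletonClass 𝒳] [Countable 𝒳]

theorem IsMemoryBound.setLIntegral_exp_logIncr_le {μ : Measure (Path 𝒳)} [IsProbabilityMeasure μ]
    (hμ : MeasurePreserving (shift : Path 𝒳 → _) μ μ) {b s : ℕ → 𝒳} {k m : ℕ}
    (hb : IsMemoryBound μ b k) (hkm : k ≤ m) (hs : ∀ j < k, s j = b j) (x : 𝒳) {c : ℝ}
    (hc : |c| ≤ 1) {T : ℕ} (hm : m ≤ T + 1) (r : ℕ → 𝒳) :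
    ∫⁻ ω in {ω | OccursAt ω (T + 1) r T},
      ENNReal.ofReal (Real.exp (logIncr c (pcond μ k x b) m x s (T : ℤ) ω)) ∂μ ≤
        μ {ω | OccursAt ω (T + 1) r T} := by
  have hmeas := measurableSet_occursAt (𝒳 := 𝒳) (T + 1) r T
  have hiff : ∀ ω, OccursAt ω (T + 1) r T → (OccursAt ω m s T ↔ ∀ j < m, r j = s j) :=
    fun ω hω => forall₂_congr fun j hj => by rw [hω j (hj.trans_le hm)]
  by_cases hrs : ∀ j < m, r j = s j
  · set p := pcond μ k x b with hp
    have hx := measurableSet_coord_eq (𝒳 := 𝒳) (T + 1) x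
    set A := {ω : Path 𝒳 | OccursAt ω (T + 1) r T} with hA
    set B := {ω : Path 𝒳 | ω (T + 1) = x} with hB
    have hAB : (μ (A ∩ B)).toReal = p * (μ A).toReal :=
      hb.toReal_measure_occursAt hμ (hkm.trans hm)
        (fun j hj => (hrs j (hj.trans_le hkm)).trans (hs j hj)) x T
    have hAd : (μ (A \ B)).toReal = (1 - p) * (μ A).toReal := by
      have := congrArg ENNReal.toReal (measure_inter_add_sdiff (μ := μ) A hx)
      rw [ENNReal.toReal_add (measure_ne_top _ _) (measure_ne_top _ _)] at this
      linarith
    have h1 : ∫⁻ ω in A ∩ B, ENNReal.ofReal (Real.exp (logIncr c p m x s (T : ℤ) ω)) ∂μ =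
        ENNReal.ofReal (Real.exp (c * (1 - p) - c ^ 2)) * μ (A ∩ B) := by
      rw [← setLIntegral_const]
      refine setLIntegral_congr_fun (hmeas.inter hx) fun ω hω => ?_
      have h2 : ω (T + 1) = x := hω.2
      simp only [logIncr, (hiff ω hω.1).mpr hrs, h2, if_true]
    have h2 : ∫⁻ ω in A \ B, ENNReal.ofReal (Real.exp (logIncr c p m x s (T : ℤ) ω)) ∂μ =
        ENNReal.ofReal (Real.exp (c * (0 - p) - c ^ 2)) * μ (A \ B) := by
      rw [← setLIntegral_const]
      refine setLIntegral_congr_fun (hmeas.diff hx) fun ω hω => ?_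
      have h2 : ¬ ω (T + 1) = x := hω.2
      simp only [logIncr, (hiff ω hω.1).mpr hrs, h2, if_true, if_false]
    have hp1 := pcond_le_one μ k x b
    have hp0 := pcond_nonneg μ k x b
    rw [← lintegral_inter_add_sdiff _ _ hx, h1, h2, ← ENNReal.ofReal_toReal (measure_ne_top μ A),
      ← ENNReal.ofReal_toReal (measure_ne_top μ (A ∩ B)),
      ← ENNReal.ofReal_toReal (measure_ne_top μ (A \ B)), hAB, hAd,
      ← ENNReal.ofReal_mul (Real.exp_pos _).le, ← ENNReal.ofReal_mul (Real.exp_pos _).le,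
      ← ENNReal.ofReal_add]
    · refine ENNReal.ofReal_le_ofReal ?_
      have := mul_le_mul_of_nonneg_right (bernoulli_exp_le_one hc hp0 hp1)
        (ENNReal.toReal_nonneg (a := μ A))
      linarith
    · rw [← hAB]; positivity
    · rw [← hAd]; positivity
  · refine le_of_eq ?_
    rw [← setLIntegral_one]
    refine setLIntegral_congr_fun hmeas fun ω hω => ?_
    simp [logIncr, mt (hiff ω hω).mp hrs]

/-- The compensated exponential weight is a supermartingale after time `a`. -/
theorem IsMemoryBound.lintegral_exp_sum_logIncr_le {μ : Measure (Path 𝒳)} [IsProbabilityMeasure μ]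
    (hμ : MeasurePreserving (shift : Path 𝒳 → _) μ μ) {b s : ℕ → 𝒳} {k m : ℕ}
    (hb : IsMemoryBound μ b k) (hkm : k ≤ m) (hs : ∀ j < k, s j = b j) (x : 𝒳) {c : ℝ}
    (hc : |c| ≤ 1) {a : ℕ} (hm : m ≤ a + 1) {G : Path 𝒳 → ℝ≥0∞} (hG : SegDetermined a G) (L : ℕ) :
    ∫⁻ ω, G ω * ENNReal.ofReal (Real.exp
      (∑ i ∈ Finset.range L, logIncr c (pcond μ k x b) m x s ((a + i : ℕ) : ℤ) ω)) ∂μ ≤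
        ∫⁻ ω, G ω ∂μ := by
  induction L with
  | zero => simp
  | succ L ih =>
    refine le_trans (le_of_eq ?_) (le_trans (SegDetermined.lintegral_mul_le (T := a + L)
      (G := fun ω => G ω * ENNReal.ofReal (Real.exp
        (∑ i ∈ Finset.range L, logIncr c (pcond μ k x b) m x s ((a + i : ℕ) : ℤ) ω)))
      (g := fun ω => ENNReal.ofReal (Real.exp
        (logIncr c (pcond μ k x b) m x s ((a + L : ℕ) : ℤ) ω))) ?_ ?_ ?_) ih)
    · congr 1 with ω
      rw [Finset.sum_range_succ, Real.exp_add, ENNReal.ofReal_mul (Real.exp_pos _).le, mul_assoc]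
    · intro ω ω' h
      dsimp only
      rw [hG ω ω' fun i h0 hi => h i h0 (by omega)]
      congr 3
      refine Finset.sum_congr rfl fun i hi => ?_
      have := Finset.mem_range.mp hi
      exact segDetermined_logIncr _ _ _ _ (by omega) (by omega) ω ω' h
    · exact (Real.measurable_exp.comp (segDetermined_logIncr _ _ _ _ (T := a + L + 1) (by omega)
        le_rfl).measurable).ennreal_ofReal
    · exact hb.setLIntegral_exp_logIncr_le hμ hkm hs x hc (by omega)

theorem IsMemoryBound.measure_le_sum_logIncr {μ : Measure (Path 𝒳)} [IsProbabilityMeasure μ]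
    (hμ : MeasurePreserving (shift : Path 𝒳 → _) μ μ) {b s : ℕ → 𝒳} {k m : ℕ}
    (hb : IsMemoryBound μ b k) (hkm : k ≤ m) (hs : ∀ j < k, s j = b j) (x : 𝒳) {c : ℝ}
    (hc : |c| ≤ 1) {a : ℕ} (hm : m ≤ a + 1) {A : Set (Path 𝒳)} (hA : SegDetermined a (· ∈ A))
    (L : ℕ) (r : ℝ) :
    μ (A ∩ {ω | r ≤
      ∑ i ∈ Finset.range L, logIncr c (pcond μ k x b) m x s ((a + i : ℕ) : ℤ) ω}) ≤
        ENNReal.ofReal (Real.exp (-r)) * μ A := by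
  set Z : Path 𝒳 → ℝ := fun ω =>
    ∑ i ∈ Finset.range L, logIncr c (pcond μ k x b) m x s ((a + i : ℕ) : ℤ) ω with hZ
  have hAm : MeasurableSet A := measurableSet_setOfPred.mpr hA.measurable
  have hZm : Measurable Z := by
    refine Finset.measurable_sum _ fun i _ => ?_
    exact (segDetermined_logIncr _ _ _ _ (T := a + i + 1) (by omega) le_rfl).measurable
  have hG : SegDetermined a (A.indicator (1 : Path 𝒳 → ℝ≥0∞)) := by
    classical
    intro ω ω' h
    simp only [Set.indicator_apply, eq_iff_iff.mp (hA ω ω' h), Pi.one_apply]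
  have h1 := hb.lintegral_exp_sum_logIncr_le hμ hkm hs x hc hm hG L
  rw [lintegral_indicator_one hAm] at h1
  have h2 := mul_meas_ge_le_lintegral (μ := μ)
    (f := fun ω => A.indicator (1 : Path 𝒳 → ℝ≥0∞) ω * ENNReal.ofReal (Real.exp (Z ω)))
    ((measurable_one.indicator hAm).mul (Real.measurable_exp.comp hZm).ennreal_ofReal)
    (ENNReal.ofReal (Real.exp r))
  have h3 : A ∩ {ω | r ≤ Z ω} ⊆ {ω | ENNReal.ofReal (Real.exp r) ≤
      A.indicator (1 : Path 𝒳 → ℝ≥0∞) ω * ENNReal.ofReal (Real.exp (Z ω))} := by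
    rintro ω ⟨hω, hr⟩
    simp only [Set.mem_ofPred_eq, Set.indicator_of_mem hω, Pi.one_apply, one_mul]
    exact ENNReal.ofReal_le_ofReal (Real.exp_le_exp.mpr hr)
  have h4 : ENNReal.ofReal (Real.exp r) * μ (A ∩ {ω | r ≤ Z ω}) ≤ μ A :=
    (mul_le_mul_right (measure_mono h3) _).trans (h2.trans h1)
  calc μ (A ∩ {ω | r ≤ Z ω}) =
      ENNReal.ofReal (Real.exp (-r)) * (ENNReal.ofReal (Real.exp r) * μ (A ∩ {ω | r ≤ Z ω})) := by
        rw [← mul_assoc, ← ENNReal.ofReal_mul (Real.exp_pos _).le, ← Real.exp_add]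
        simp
    _ ≤ _ := mul_le_mul_right h4 _

end Chernoff

/-- If `M` out of `N` trials succeed and `M / N` is further than `ε` from `p`, then one of the
compensated logarithmic weights with parameter `± ε / 2` is at least `ε ^ 2 * N / 4`. -/
theorem exists_weight_of_abs_div_sub_gt {M N p ε : ℝ} (hN : 0 < N) (hε : 0 < ε)
    (h : ε < |M / N - p|) :
    ∃ c ∈ ({ε / 2, -(ε / 2)} : Set ℝ),
      ε ^ 2 * N / 4 ≤ c * (M - p * N) - c ^ 2 * N := by
  have hM : M - p * N = (M / N - p) * N := by field_simp
  rw [hM]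
  rcases lt_abs.mp h with h | h
  · refine ⟨ε / 2, by simp, ?_⟩
    nlinarith [mul_lt_mul_of_pos_right h (mul_pos hε hN)]
  · refine ⟨-(ε / 2), by simp, ?_⟩
    nlinarith [mul_lt_mul_of_pos_right h (mul_pos hε hN)]

section Deviation

variable [MeasurableSingletonClass 𝒳] [Countable 𝒳]

/-- Deviation bound for the empirical conditional frequency after an extension of a memory word,
on an event determined by the first half of the data. -/
theorem IsMemoryBound.measure_empCond_deviation_le {μ : Measure (Path 𝒳)} [IsProbabilityMeasure μ]
    (hμ : MeasurePreserving (shift : Path 𝒳 → _) μ μ) {b s : ℕ → 𝒳} {k m : ℕ}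
    (hb : IsMemoryBound μ b k) (hkm : k ≤ m) (hs : ∀ j < k, s j = b j) (x : 𝒳) {ε q : ℝ}
    (hε : 0 < ε) (hε1 : ε ≤ 2) (hq : 0 ≤ q) {n : ℕ} (hn : 1 ≤ n) {A : Set (Path 𝒳)}
    (hA : SegDetermined (half n - 1) (· ∈ A)) :
    μ (A ∩ {ω | q < cnt ω (m + 1) (withLast x s) ((half n : ℤ) + m) n ∧
      ε < |empCond ω n m x s - pcond μ k x b|}) ≤
        ENNReal.ofReal (2 * Real.exp (-(ε ^ 2 * q / 4))) * μ A := by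
  have hhalf : 1 ≤ half n := by unfold half; omega
  obtain ⟨a, ha⟩ : ∃ a : ℕ, half n + m = a + 1 := ⟨half n + m - 1, by omega⟩
  have hAa : SegDetermined a (· ∈ A) := fun ω ω' h =>
    hA ω ω' fun i h0 hi => h i h0 (by omega)
  set p := pcond μ k x b
  have hc : |ε / 2| ≤ 1 := by rw [abs_of_pos (by positivity)]; linarith
  have hbound := fun c hc => hb.measure_le_sum_logIncr hμ hkm hs x (c := c) hc
    (a := a) (by omega) hAa (n - a) (ε ^ 2 * q / 4)
  have hsub : A ∩ {ω | q < cnt ω (m + 1) (withLast x s) ((half n : ℤ) + m) n ∧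
      ε < |empCond ω n m x s - p|} ⊆
      (A ∩ {ω | ε ^ 2 * q / 4 ≤
        ∑ i ∈ Finset.range (n - a), logIncr (ε / 2) p m x s ((a + i : ℕ) : ℤ) ω}) ∪
      (A ∩ {ω | ε ^ 2 * q / 4 ≤
        ∑ i ∈ Finset.range (n - a), logIncr (-(ε / 2)) p m x s ((a + i : ℕ) : ℤ) ω}) := by
    rintro ω ⟨hωA, hcnt, hdev⟩
    have hne : (Finset.Icc ((half n : ℤ) + m) n).Nonempty := by
      by_contra hne
      rw [Finset.not_nonempty_iff_eq_empty] at hne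
      simp only [cnt, hne, Finset.filter_empty, Finset.card_empty, Nat.cast_zero] at hcnt
      linarith
    have han : a + 1 ≤ n := by
      have := Finset.nonempty_Icc.mp hne
      omega
    have e1 : (half n : ℤ) + m = (a : ℤ) + 1 := by exact_mod_cast ha
    have e2 : (n : ℤ) = (a : ℤ) + (n - a : ℕ) := by omega
    have e3 : (a : ℤ) + 1 - 1 = a := by ring
    unfold empCond at hdev
    rw [e1, e3, e2] at hdev
    rw [e1, e2] at hcnt
    have hMN : cnt ω (m + 1) (withLast x s) ((a : ℤ) + 1) ((a : ℤ) + (n - a : ℕ)) ≤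
        cnt ω m s a ((a : ℤ) + (n - a : ℕ) - 1) := by
      classical
      unfold cnt
      refine Finset.card_le_card_of_injOn (fun t => t - 1) ?_ fun t _ t' _ h => by simpa using h
      intro t ht
      simp only [Finset.coe_filter, Finset.mem_Icc, Set.mem_ofPred_eq] at ht ⊢
      refine ⟨by omega, ((occursAt_withLast ω m x s (t - 1)).mp ?_).1⟩
      rw [sub_add_cancel]; exact ht.2
    have hMN' := (Nat.cast_le (α := ℝ)).mpr hMN
    have hqN := hcnt.trans_le hMN'
    obtain ⟨c, hc, hle⟩ := exists_weight_of_abs_div_sub_gt (hq.trans_lt hqN) hε hdev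
    rw [← sum_logIncr] at hle
    have hle' : ε ^ 2 * q / 4 ≤ _ := le_trans (by gcongr) hle
    rcases hc with rfl | rfl
    · exact Or.inl ⟨hωA, hle'⟩
    · exact Or.inr ⟨hωA, hle'⟩
  refine (measure_mono hsub).trans ((measure_union_le _ _).trans
    ((add_le_add (hbound _ hc) (hbound _ (by rwa [abs_neg]))).trans (le_of_eq ?_)))
  rw [← two_mul, ← mul_assoc, ENNReal.ofReal_mul zero_le_two]
  simp

/-- The event that the string of length `k + i + 1` ending at time `t` extends the memory word `b`,
is frequent in the second half of the data, and violates the `δ`-closeness of the empirical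
conditional frequencies. -/
def deviationSet {α : Type*} (γ δ : ℝ) (b : ℕ → α) (k n i t : ℕ) : Set (Path α) :=
  {ω | (∀ j < k, ω ((t : ℤ) - (j + 1 : ℕ)) = b j) ∧
    inL2 γ ω n (k + i) (fun j => ω ((t : ℤ) - j)) ∧
    δ < |empCond ω n k (ω t) b - empCond ω n (k + i) (ω t) (fun j => ω ((t : ℤ) - (j + 1 : ℕ)))|}

theorem IsMemoryBound.measure_deviationSet_le {μ : Measure (Path 𝒳)} [IsProbabilityMeasure μ]
    (hμ : MeasurePreserving (shift : Path 𝒳 → _) μ μ) {b : ℕ → 𝒳} {k : ℕ}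
    (hb : IsMemoryBound μ b k) {γ δ : ℝ} (hδ : 0 < δ) (hδ1 : δ ≤ 1) {n i t : ℕ}
    (hkt : k + i ≤ t) (htn : t + 1 ≤ half n) :
    μ (deviationSet γ δ b k n i t) ≤
      ENNReal.ofReal (4 * Real.exp (-(δ ^ 2 * (n : ℝ) ^ (1 - γ) / 16))) := by
  have hn : 1 ≤ n := by unfold half at htn; omega
  refine measure_le_mul_of_fiber μ (measurable_seg (k + i + 1) (t : ℤ)) fun ω₀ hω₀ => ?_
  have hA : SegDetermined (half n - 1)
      (· ∈ seg (k + i + 1) (t : ℤ) ⁻¹' {seg (k + i + 1) (t : ℤ) ω₀}) := by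
    intro ω ω' h
    rw [seg_preimage_singleton]
    exact propext (forall₂_congr fun j hj => by rw [h _ (by omega) (by omega)])
  set A := seg (k + i + 1) (t : ℤ) ⁻¹' {seg (k + i + 1) (t : ℤ) ω₀} with hAdef
  set x := ω₀ t
  set s : ℕ → 𝒳 := fun j => ω₀ ((t : ℤ) - (j + 1 : ℕ))
  have hs : withLast x s = fun j : ℕ => ω₀ ((t : ℤ) - j) := by
    funext j
    cases j <;> simp [withLast, x, s]
  have hq : (0 : ℝ) ≤ (n : ℝ) ^ (1 - γ) := by positivity
  have h1 := hb.measure_empCond_deviation_le hμ (Nat.le_add_right k i) (s := s) hω₀.1 x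
    (half_pos hδ) (by linarith) hq hn hA
  have h2 := hb.measure_empCond_deviation_le hμ le_rfl (fun _ _ => rfl) x
    (half_pos hδ) (by linarith) hq hn hA
  have hsub : A ∩ deviationSet γ δ b k n i t ⊆
      (A ∩ {ω | (n : ℝ) ^ (1 - γ) <
          cnt ω (k + i + 1) (withLast x s) ((half n : ℤ) + (k + i : ℕ)) n ∧
        δ / 2 < |empCond ω n (k + i) x s - pcond μ k x b|}) ∪
      (A ∩ {ω | (n : ℝ) ^ (1 - γ) < cnt ω (k + 1) (withLast x b) ((half n : ℤ) + k) n ∧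
        δ / 2 < |empCond ω n k x b - pcond μ k x b|}) := by
    rintro ω ⟨hωA, -, hL, hdev⟩
    have hocc : ∀ j < k + i + 1, ω ((t : ℤ) - j) = ω₀ ((t : ℤ) - j) := by
      have := hωA
      rwa [hAdef, seg_preimage_singleton] at this
    have hx : ω t = x := by simpa using hocc 0 (by omega)
    rw [hx, empCond_congr ω n x (s' := s) fun j hj => hocc (j + 1) (by omega)] at hdev
    unfold inL2 at hL
    rw [cnt_congr ω (s' := withLast x s) (fun j hj => by rw [hs]; exact hocc j hj)] at hL
    have hL' : (n : ℝ) ^ (1 - γ) < cnt ω (k + 1) (withLast x b) ((half n : ℤ) + k) n := by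
      refine hL.trans_le (Nat.cast_le.mpr (cnt_mono_left (by omega) (by omega) fun j hj => ?_))
      unfold withLast
      split_ifs with h0
      · rfl
      · exact hω₀.1 _ (by omega)
    by_cases hle : δ / 2 < |empCond ω n (k + i) x s - pcond μ k x b|
    · exact Or.inl ⟨hωA, hL, hle⟩
    · refine Or.inr ⟨hωA, hL', ?_⟩
      have := abs_sub_le (empCond ω n k x b) (pcond μ k x b) (empCond ω n (k + i) x s)
      rw [abs_sub_comm (pcond μ k x b)] at this
      linarith
  refine (measure_mono hsub).trans ((measure_union_le _ _).trans
    ((add_le_add h1 h2).trans (le_of_eq ?_)))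
  rw [← two_mul, ← mul_assoc, ← ENNReal.ofReal_ofNat 2, ← ENNReal.ofReal_mul zero_le_two]
  congr 2
  rw [← mul_assoc]
  congr 2 <;> ring_nf

theorem summable_sq_mul_exp_neg_rpow {d c : ℝ} (hd : 0 < d) (hc : 0 < c) :
    Summable fun n : ℕ => (n : ℝ) ^ 2 * (4 * Real.exp (-(c * (n : ℝ) ^ d))) := by
  have h1 := (isLittleO_exp_neg_mul_rpow_atTop hc (-4 / d)).comp_tendsto
    ((tendsto_rpow_atTop hd).comp tendsto_natCast_atTop_atTop)
  have h2 : (fun n : ℕ => (n : ℝ) ^ 2 * (4 * Real.exp (-(c * (n : ℝ) ^ d)))) =O[atTop]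
      fun n : ℕ => (n : ℝ) ^ (-2 : ℝ) := by
    have h3 := ((Asymptotics.isBigO_refl (fun n : ℕ => (n : ℝ) ^ 2 * 4) atTop).mul h1.isBigO)
    refine (h3.congr' ?_ EventuallyEq.rfl).trans ?_
    · filter_upwards with n
      simp only [Function.comp_apply, neg_mul, mul_assoc]
    · refine Asymptotics.IsBigO.of_bound 4 ?_
      filter_upwards [eventually_ge_atTop 1] with n hn
      have hn0 : (0 : ℝ) < n := by exact_mod_cast hn
      simp only [Function.comp_apply]
      rw [← Real.rpow_mul hn0.le, mul_div_cancel₀ _ hd.ne', mul_right_comm, mul_comm,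
        ← Real.rpow_natCast, ← Real.rpow_add hn0, norm_mul]
      norm_num
  exact summable_of_isBigO_nat (Real.summable_nat_rpow.mpr (by norm_num)) h2

theorem IsMemoryBound.ae_eventually_notMem_deviationSet {μ : Measure (Path 𝒳)}
    [IsProbabilityMeasure μ] (hμ : MeasurePreserving (shift : Path 𝒳 → _) μ μ) {b : ℕ → 𝒳} {k : ℕ}
    (hb : IsMemoryBound μ b k) {β γ : ℝ} (hβ : 0 < β) (hβγ : 2 * β + γ < 1) :
    ∀ᵐ ω ∂μ, ∀ᶠ n : ℕ in atTop, ∀ i t : ℕ, 1 ≤ i → k + i ≤ t → t + 1 ≤ half n →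
      ω ∉ deviationSet γ ((n : ℝ) ^ (-β)) b k n i t := by
  let I : ℕ → Finset (ℕ × ℕ) := fun n =>
    (Finset.range n ×ˢ Finset.range n).filter fun q => k + q.1 ≤ q.2 ∧ q.2 + 1 ≤ half n
  let E : ℕ → Set (Path 𝒳) := fun n =>
    ⋃ q ∈ I n, deviationSet γ ((n : ℝ) ^ (-β)) b k n q.1 q.2
  have hE : ∀ n, μ (E n) ≤ ENNReal.ofReal
      ((n : ℝ) ^ 2 * (4 * Real.exp (-(1 / 16 * (n : ℝ) ^ (1 - γ - 2 * β))))) := by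
    intro n
    rcases Nat.eq_zero_or_pos n with rfl | hn
    · simp [E, I]
    have hn1 : (1 : ℝ) ≤ n := by exact_mod_cast hn
    have hn0 : (0 : ℝ) < n := by linarith
    have hexp : ((n : ℝ) ^ (-β)) ^ 2 * (n : ℝ) ^ (1 - γ) / 16 =
        1 / 16 * (n : ℝ) ^ (1 - γ - 2 * β) := by
      rw [← Real.rpow_natCast, ← Real.rpow_mul hn0.le, ← Real.rpow_add hn0, mul_comm (1 / 16),
        mul_one_div]
      congr 2
      push_cast; ring
    calc μ (E n) ≤ ∑ q ∈ I n, μ (deviationSet γ ((n : ℝ) ^ (-β)) b k n q.1 q.2) :=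
          measure_biUnion_finset_le _ _
      _ ≤ ∑ q ∈ I n, ENNReal.ofReal (4 * Real.exp (-(1 / 16 * (n : ℝ) ^ (1 - γ - 2 * β)))) := by
          refine Finset.sum_le_sum fun q hq => ?_
          obtain ⟨-, h1, h2⟩ := Finset.mem_filter.mp hq
          rw [← hexp]
          exact hb.measure_deviationSet_le hμ (by positivity)
            (Real.rpow_le_one_of_one_le_of_nonpos hn1 (by linarith)) h1 h2
      _ ≤ ((n * n : ℕ) : ℝ≥0∞) *
            ENNReal.ofReal (4 * Real.exp (-(1 / 16 * (n : ℝ) ^ (1 - γ - 2 * β)))) := by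
          rw [Finset.sum_const, nsmul_eq_mul]
          gcongr
          refine (Finset.card_filter_le _ _).trans ?_
          simp
      _ = _ := by
          rw [ENNReal.ofReal_mul (sq_nonneg (n : ℝ)), sq, ← Nat.cast_mul, ENNReal.ofReal_natCast]
  have hsum : ∑' n, μ (E n) ≠ ∞ := by
    refine ne_top_of_le_ne_top ?_ (ENNReal.tsum_le_tsum hE)
    exact (summable_sq_mul_exp_neg_rpow (by linarith) (by norm_num)).tsum_ofReal_ne_top
  filter_upwards [ae_eventually_notMem hsum] with ω hω
  filter_upwards [hω] with n hn i t hi hkt htn hmem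
  refine hn (Set.mem_biUnion (x := (i, t)) ?_ hmem)
  have : half n ≤ n := by unfold half at htn ⊢; omega
  simp only [I, Finset.coe_filter, Finset.mem_product, Finset.mem_range, Set.mem_ofPred_eq]
  omega

end Deviation

theorem hatDelta_le_of_notMem_deviationSet {α : Type*} {γ δ : ℝ} (hδ : 0 ≤ δ) {l : ℕ → ℕ}
    {ω : Path α} {n k : ℕ} {b : ℕ → α} (hb : ∀ j < k, tildePast l ω j = b j)
    (h : ∀ i t : ℕ, 1 ≤ i → k + i ≤ t → t + 1 ≤ half n → ω ∉ deviationSet γ δ b k n i t) :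
    hatDelta γ l ω n k ≤ δ := by
  unfold hatDelta
  split_ifs
  · rw [one_mul]
    refine Real.sSup_le ?_ hδ
    rintro _ ⟨i, hi, -, z, x, ⟨⟨t', ht', hth, hocc⟩, hL2⟩, rfl⟩
    lift t' to ℕ using (by omega)
    by_contra! hlt
    have hx : ω t' = x := by simpa [withLast] using hocc 0 (by omega)
    have hw : ∀ j < k + i, ω ((t' : ℤ) - (j + 1 : ℕ)) = prependOld (tildePast l ω) k z j := by
      intro j hj
      simpa [withLast] using hocc (j + 1) (by omega)
    refine h i t' hi (by omega) (by omega) ⟨fun j hj => ?_, ?_, ?_⟩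
    · rw [hw j (by omega), prependOld, if_pos hj, hb j hj]
    · unfold inL2 at hL2 ⊢
      rwa [cnt_congr ω hocc]
    · rwa [hx, empCond_congr ω n x hw, ← empCond_congr ω n x hb]
  · rw [zero_mul]; exact hδ

theorem ae_eventually_hatDelta_le [Countable 𝒳] [MeasurableSingletonClass 𝒳]
    {μ : Measure (Path 𝒳)} [IsProbabilityMeasure μ]
    (hμ : MeasurePreserving (shift : Path 𝒳 → _) μ μ) (l : ℕ → ℕ) {β γ : ℝ} (hβ : 0 < β)
    (hβγ : 2 * β + γ < 1) (k : ℕ) :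
    ∀ᵐ ω ∂μ, memLen μ (tildePast l ω) = (k : ℕ∞) →
      ∀ᶠ n : ℕ in atTop, hatDelta γ l ω n k ≤ (n : ℝ) ^ (-β) := by
  obtain ⟨ω₀⟩ : Nonempty (Path 𝒳) := μ.nonempty_of_neZero
  let extend : (Fin k → 𝒳) → ℕ → 𝒳 := fun v j => if h : j < k then v ⟨j, h⟩ else ω₀ 0
  have hall : ∀ᵐ ω ∂μ, ∀ v : Fin k → 𝒳, IsMemoryBound μ (extend v) k →
      ∀ᶠ n : ℕ in atTop, ∀ i t : ℕ, 1 ≤ i → k + i ≤ t → t + 1 ≤ half n →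
        ω ∉ deviationSet γ ((n : ℝ) ^ (-β)) (extend v) k n i t := by
    refine ae_all_iff.mpr fun v => ?_
    by_cases hv : IsMemoryBound μ (extend v) k
    · filter_upwards [hv.ae_eventually_notMem_deviationSet hμ hβ hβγ] with ω hω _ using hω
    · exact Eventually.of_forall fun ω h => absurd h hv
  filter_upwards [hall] with ω hω hmem
  have hext : ∀ j < k, tildePast l ω j = extend (fun j => tildePast l ω j) j := by
    intro j hj
    simp only [extend, dif_pos hj]
  filter_upwards [hω (fun j => tildePast l ω j) ((isMemoryBound_of_memLen_eq hmem).congr hext)] with n hn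
  exact hatDelta_le_of_notMem_deviationSet (by positivity) hext hn

/-- conclusion of Step 2. For every `k`,
`P(Δ̂_k^n ≤ n^{-β} eventually, K(X̃⁰_{-∞}) = k) = P(K(X̃⁰_{-∞}) = k)`, and
consequently almost surely on `{K(X̃⁰_{-∞}) = k}` one has `χ_n ≤ k`
eventually. -/
theorem statement19
    {𝒳 : Type*} [Countable 𝒳] [MeasurableSpace 𝒳] [MeasurableSingletonClass 𝒳]
    (μ : Measure (Path 𝒳)) [IsProbabilityMeasure μ]
    (hErg : Ergodic (shift : Path 𝒳 → Path 𝒳) μ)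
    (l : ℕ → ℕ) (hl1 : l 1 = 1) (hlmono : Monotone l)
    (hlle : ∀ k, 1 ≤ k → l k ≤ k) (hltop : Tendsto l atTop atTop)
    (β γ : ℝ) (hγ0 : 0 < γ) (hγ1 : γ < 1) (hβ0 : 0 < β) (hβγ : 2 * β + γ < 1) :
    ∀ k : ℕ,
      μ ({ω | ∀ᶠ n in atTop, hatDelta γ l ω n k ≤ (n : ℝ) ^ (-β)} ∩
          {ω | memLen μ (tildePast l ω) = (k : ℕ∞)}) =
        μ {ω | memLen μ (tildePast l ω) = (k : ℕ∞)} ∧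
      (∀ᵐ ω ∂μ, memLen μ (tildePast l ω) = (k : ℕ∞) →
        ∀ᶠ n in atTop, chi β γ l ω n ≤ k) := by
  intro k
  have h := ae_eventually_hatDelta_le hErg.toMeasurePreserving l hβ0 hβγ k
  refine ⟨measure_congr ?_, ?_⟩
  · filter_upwards [h] with ω hω
    exact propext ⟨fun hω' => hω'.2, fun hω' => ⟨hω hω', hω'⟩⟩
  · filter_upwards [h] with ω hω hk
    filter_upwards [hω hk, eventually_gt_atTop k] with n hn hkn
    exact Nat.sInf_le ⟨hkn, hn⟩

end MWPrediction
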